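/- (Lemma 3.3: dissipation from the pressure.) Let (η,u,v,p) be a sufficiently smooth solution of the transformed system and set ∂_y^{-1}f(x,y) = −∫_y^1 f(x,z) dz. Then (2/R)(δ p_x, u)_Ω + (1/(3R))( (1/tan²α) δ²|η_x|₀² + (2δ²W/(tan α sin α)) δ²|η_{xx}|₀² + ((δ²W)²/sin²α) δ²|η_{xxx}|₀² ) + (1/R) δ² ‖∂_y^{-1} p_x‖² ≤ I₁ + I₂ + I₃, where I₁ = −(2/R)( δ ∂_y^{-1} p_x, (2+b₃)η )_Ω, I₂ = −(2/R)( δ ∂_y^{-1} p_x, −δ² v_x(·,1) + h₁ + ∂_y^{-1}( u_{yy} − 2δ p_x ) )_Ω, and I₃ = (1/R)( 2δ⁴|u_{xx}|₀² + 2δ²|h_{2x}|₀² + 3δ²‖∂_y^{-2} p_{xy}‖² ). -/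

import Mathlib

open MeasureTheory Real

noncomputable section

/-- Functions on `Ω × ℝ_t`, `Ω = 𝕋 × (0,1)` (the torus `𝕋 = ℝ/ℤ` is modelled by
`1`-periodic functions of `x`); arguments `(x, y, t)`. -/
abbrev OF : Type := ℝ → ℝ → ℝ → ℝ
/-- Functions on `Γ × ℝ_t`; arguments `(x, t)`. -/
abbrev GF : Type := ℝ → ℝ → ℝ

def pdx (f : OF) : OF := fun x y t => deriv (fun s => f s y t) x
def pdy (f : OF) : OF := fun x y t => deriv (fun s => f x s t) y
def pdt (f : OF) : OF := fun x y t => deriv (fun s => f x y s) t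
def pdxn (n : ℕ) (f : OF) : OF := pdx^[n] f
def pdyn (n : ℕ) (f : OF) : OF := pdy^[n] f
def gdx (g : GF) : GF := fun x t => deriv (fun s => g s t) x
def gdt (g : GF) : GF := fun x t => deriv (fun s => g x s) t
def gdxn (n : ℕ) (g : GF) : GF := gdx^[n] g

/-- Squared `L²(Ω)` norm at time `t`. -/
def nO (f : OF) (t : ℝ) : ℝ := ∫ x in (0:ℝ)..1, ∫ y in (0:ℝ)..1, (f x y t)^2
/-- Squared `L²(Γ)` norm at time `t`. -/
def nG (g : GF) (t : ℝ) : ℝ := ∫ x in (0:ℝ)..1, (g x t)^2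
/-- `L²(Ω)` inner product at time `t`. -/
def ipO (f g : OF) (t : ℝ) : ℝ := ∫ x in (0:ℝ)..1, ∫ y in (0:ℝ)..1, f x y t * g x y t
/-- `L²(Γ)` inner product at time `t`. -/
def ipG (f g : GF) (t : ℝ) : ℝ := ∫ x in (0:ℝ)..1, f x t * g x t
/-- Trace on `Γ = {y = 1}`. -/
def tr (f : OF) : GF := fun x t => f x 1 t
/-- `∂_y^{-1} f(x,y,t) = −∫_y^1 f(x,z,t) dz`. -/
def iy (f : OF) : OF := fun x y t => -∫ z in y..1, f x z t

/-- "Sufficiently smooth": jointly smooth and `1`-periodic in `x`. -/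
def SmoothO (f : OF) : Prop :=
  (∀ n : ℕ, ContDiff ℝ n (fun q : ℝ × ℝ × ℝ => f q.1 q.2.1 q.2.2)) ∧
    ∀ y t : ℝ, Function.Periodic (fun x => f x y t) 1
def SmoothG (g : GF) : Prop :=
  (∀ n : ℕ, ContDiff ℝ n (fun q : ℝ × ℝ => g q.1 q.2)) ∧
    ∀ t : ℝ, Function.Periodic (fun x => g x t) 1

/-- `n`-th Fourier coefficient in `x` of a `Γ`-function at time `t`. -/
def fcG (g : GF) (t : ℝ) (n : ℤ) : ℂ :=
  ∫ x in (0:ℝ)..1, Complex.exp (-(2 * π * (n : ℝ) * x : ℝ) * Complex.I) * (g x t : ℂ)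
/-- `n`-th Fourier coefficient in `x` of an `Ω`-function at height `y`, time `t`. -/
def fcO (f : OF) (y t : ℝ) (n : ℤ) : ℂ :=
  ∫ x in (0:ℝ)..1, Complex.exp (-(2 * π * (n : ℝ) * x : ℝ) * Complex.I) * (f x y t : ℂ)

/-- The symbol `2π|n|` of the Fourier multiplier `|D_x|`. -/
def tp (n : ℤ) : ℝ := 2 * π * |(n : ℝ)|
/-- Squared weighted (Fourier multiplier) trace norm on `Γ`. -/
def wG (w : ℤ → ℝ) (g : GF) (t : ℝ) : ℝ := ∑' n : ℤ, (w n)^2 * ‖fcG g t n‖^2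
/-- Squared weighted (Fourier multiplier in `x`) norm on `Ω`. -/
def wO (w : ℤ → ℝ) (f : OF) (t : ℝ) : ℝ :=
  ∫ y in (0:ℝ)..1, ∑' n : ℤ, (w n)^2 * ‖fcO f y t n‖^2
/-- The `H^m(𝔾)` weight `(1 + (2πn)²)^{m/2}`. -/
def hwt (m : ℕ) (n : ℤ) : ℝ := (Real.sqrt (1 + (2 * π * (n : ℝ))^2))^m

/-- The transformed film-flow system (2.20)–(2.22): the linear part is written out
explicitly (with `U = (2y−y²,0)ᵀ`, `u^δ = (u,δv)ᵀ`), and the nonlinear terms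
`A₄ = (aᵢⱼ)` (symmetric), `A₃ = diag(b₂,0)`, `f = (f₁,f₂)ᵀ`, `b₃`, `h₁`, `h₂`, `h₃`
are given functions. -/
structure FilmSystem (δ R W α : ℝ) (η : GF) (u v p : OF)
    (a11 a12 a22 b2 : OF) (f1 f2 : OF) (b3 h1 h2 h3 : GF) : Prop where
  smooth_η : SmoothG η
  smooth_u : SmoothO u
  smooth_v : SmoothO v
  smooth_p : SmoothO p
  smooth_a11 : SmoothO a11
  smooth_a12 : SmoothO a12
  smooth_a22 : SmoothO a22
  smooth_b2 : SmoothO b2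
  smooth_f1 : SmoothO f1
  smooth_f2 : SmoothO f2
  smooth_b3 : SmoothG b3
  smooth_h1 : SmoothG h1
  smooth_h2 : SmoothG h2
  smooth_h3 : SmoothG h3
  /-- first component of the momentum equation -/
  mom1 : ∀ x t : ℝ, ∀ y ∈ Set.Ioo (0:ℝ) 1,
    δ * pdt u x y t + (2*y - y^2) * (δ * pdx u x y t) + (2 - 2*y) * (δ * v x y t)
      + (2/R) * ((1 + a11 x y t) * (δ * pdx p x y t) + a12 x y t * pdy p x y t)
      - (1/R) * (δ^2 * pdxn 2 u x y t + (1 + b2 x y t) * pdyn 2 u x y t) = f1 x y t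
  /-- second component of the momentum equation -/
  mom2 : ∀ x t : ℝ, ∀ y ∈ Set.Ioo (0:ℝ) 1,
    δ^2 * pdt v x y t + (2*y - y^2) * (δ^2 * pdx v x y t)
      + (2/R) * (a12 x y t * (δ * pdx p x y t) + (1 + a22 x y t) * pdy p x y t)
      - (1/R) * (δ^3 * pdxn 2 v x y t + δ * pdyn 2 v x y t) = f2 x y t
  /-- incompressibility -/
  incompr : ∀ x t : ℝ, ∀ y ∈ Set.Ioo (0:ℝ) 1, pdx u x y t + pdy v x y t = 0
  /-- tangential stress boundary condition on `Γ` -/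
  bc1 : ∀ x t : ℝ, δ^2 * pdx v x 1 t + pdy u x 1 t - (2 + b3 x t) * η x t = h1 x t
  /-- normal stress boundary condition on `Γ` -/
  bc2 : ∀ x t : ℝ, p x 1 t - δ * pdy v x 1 t - (1/Real.tan α) * η x t
      + (δ^2 * W / Real.sin α) * gdxn 2 η x t = h2 x t
  /-- kinematic boundary condition on `Γ` -/
  bc3 : ∀ x t : ℝ, gdt η x t + gdx η x t - v x 1 t = h3 x t
  /-- no-slip condition on `Σ` -/
  noslip : ∀ x t : ℝ, u x 0 t = 0 ∧ v x 0 t = 0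

/-- `K` is a Korn constant for `Ω` (Lemma 3.1), uniformly in `0 < δ ≤ 1`. -/
def KornConst (K : ℝ) : Prop :=
  0 < K ∧ ∀ δ : ℝ, δ ∈ Set.Ioc (0:ℝ) 1 → ∀ u v : OF, SmoothO u → SmoothO v →
    (∀ x t : ℝ, ∀ y ∈ Set.Ioo (0:ℝ) 1, pdx u x y t + pdy v x y t = 0) →
    (∀ x t : ℝ, u x 0 t = 0 ∧ v x 0 t = 0) →
    ∀ t : ℝ,
      δ^2 * nO (pdx u) t + nO (pdy u) t + δ^4 * nO (pdx v) t + δ^2 * nO (pdy v) t ≤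
        K * (2 * δ^2 * nO (pdx u) t
          + nO (fun x y s => pdy u x y s + δ^2 * pdx v x y s) t
          + 2 * δ^2 * nO (pdy v) t)

theorem SmoothO.hasDerivAt_x {f : OF} (hf : SmoothO f) (x y t : ℝ) :
    HasDerivAt (fun s => f s y t) (pdx f x y t) x := by
  have h1 : Differentiable ℝ (fun q : ℝ × ℝ × ℝ => f q.1 q.2.1 q.2.2) :=
    (hf.1 1).differentiable (by norm_num)
  have h2 : Differentiable ℝ (fun s : ℝ => (s, y, t)) := by fun_prop
  exact ((h1.comp h2) x).hasDerivAt

theorem SmoothO.hasDerivAt_y {f : OF} (hf : SmoothO f) (x y t : ℝ) :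
    HasDerivAt (fun s => f x s t) (pdy f x y t) y := by
  have h1 : Differentiable ℝ (fun q : ℝ × ℝ × ℝ => f q.1 q.2.1 q.2.2) :=
    (hf.1 1).differentiable (by norm_num)
  have h2 : Differentiable ℝ (fun s : ℝ => (x, s, t)) := by fun_prop
  exact ((h1.comp h2) y).hasDerivAt

theorem SmoothG.hasDerivAt {g : GF} (hg : SmoothG g) (x t : ℝ) :
    HasDerivAt (fun s => g s t) (gdx g x t) x := by
  have h1 : Differentiable ℝ (fun q : ℝ × ℝ => g q.1 q.2) :=
    (hg.1 1).differentiable (by norm_num)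
  have h2 : Differentiable ℝ (fun s : ℝ => (s, t)) := by fun_prop
  exact ((h1.comp h2) x).hasDerivAt

theorem deriv_periodic {f : ℝ → ℝ} {c : ℝ} (hf : Function.Periodic f c) :
    Function.Periodic (deriv f) c := by
  intro x
  rw [← deriv_comp_add_const]
  exact congrArg (fun g => deriv g x) (funext hf)

theorem SmoothO.pdx {f : OF} (hf : SmoothO f) : SmoothO (pdx f) := by
  refine ⟨fun n => ?_, fun y t => deriv_periodic (hf.2 y t)⟩
  have h := (hf.1 (n + 1)).fderiv_right (m := n) (by norm_cast)
  have h' := h.clm_apply (contDiff_const (c := ((1 : ℝ), (0 : ℝ), (0 : ℝ))))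
  refine (congrArg (ContDiff ℝ n) (funext fun q => ?_)).mpr h'
  have h1 : Differentiable ℝ (fun q : ℝ × ℝ × ℝ => f q.1 q.2.1 q.2.2) :=
    (hf.1 1).differentiable (by norm_num)
  have h2 : HasDerivAt (fun s : ℝ => (s, q.2.1, q.2.2)) ((1 : ℝ), (0 : ℝ), (0 : ℝ)) q.1 :=
    (hasDerivAt_id _).prodMk (hasDerivAt_const _ _)
  exact ((h1 q).hasFDerivAt.comp_hasDerivAt q.1 h2).deriv

theorem SmoothO.pdy {f : OF} (hf : SmoothO f) : SmoothO (pdy f) := by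
  refine ⟨fun n => ?_, fun y t x => ?_⟩
  · have h := (hf.1 (n + 1)).fderiv_right (m := n) (by norm_cast)
    have h' := h.clm_apply (contDiff_const (c := ((0 : ℝ), (1 : ℝ), (0 : ℝ))))
    refine (congrArg (ContDiff ℝ n) (funext fun q => ?_)).mpr h'
    have h1 : Differentiable ℝ (fun q : ℝ × ℝ × ℝ => f q.1 q.2.1 q.2.2) :=
      (hf.1 1).differentiable (by norm_num)
    have h2 : HasDerivAt (fun s : ℝ => (q.1, s, q.2.2)) ((0 : ℝ), (1 : ℝ), (0 : ℝ)) q.2.1 :=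
      (hasDerivAt_const _ _).prodMk ((hasDerivAt_id _).prodMk (hasDerivAt_const _ _))
    exact ((h1 q).hasFDerivAt.comp_hasDerivAt q.2.1 h2).deriv
  · exact congrArg (fun g => deriv g y) (funext fun s => hf.2 s t x)

theorem SmoothG.gdx {g : GF} (hg : SmoothG g) : SmoothG (gdx g) := by
  refine ⟨fun n => ?_, fun t => deriv_periodic (hg.2 t)⟩
  have h := (hg.1 (n + 1)).fderiv_right (m := n) (by norm_cast)
  have h' := h.clm_apply (contDiff_const (c := ((1 : ℝ), (0 : ℝ))))
  refine (congrArg (ContDiff ℝ n) (funext fun q => ?_)).mpr h'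
  have h1 : Differentiable ℝ (fun q : ℝ × ℝ => g q.1 q.2) :=
    (hg.1 1).differentiable (by norm_num)
  have h2 : HasDerivAt (fun s : ℝ => (s, q.2)) ((1 : ℝ), (0 : ℝ)) q.1 :=
    (hasDerivAt_id _).prodMk (hasDerivAt_const _ _)
  exact ((h1 q).hasFDerivAt.comp_hasDerivAt q.1 h2).deriv

theorem SmoothO.continuous_slice {f : OF} (hf : SmoothO f) (t : ℝ) :
    Continuous (fun q : ℝ × ℝ => f q.1 q.2 t) :=
  (hf.1 0).continuous.comp (by fun_prop : Continuous fun q : ℝ × ℝ => (q.1, q.2, t))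

theorem SmoothG.continuous_slice {g : GF} (hg : SmoothG g) (t : ℝ) :
    Continuous (fun x => g x t) :=
  (hg.1 0).continuous.comp (by fun_prop : Continuous fun x : ℝ => (x, t))

theorem continuous_iy {f : OF} {t : ℝ} (hf : Continuous (fun q : ℝ × ℝ => f q.1 q.2 t)) :
    Continuous (fun q : ℝ × ℝ => iy f q.1 q.2 t) := by
  have h : ∀ q : ℝ × ℝ, iy f q.1 q.2 t = ∫ z in (1:ℝ)..q.2, f q.1 z t := fun q =>
    (intervalIntegral.integral_symm _ _).symm
  simp only [h]
  exact intervalIntegral.continuous_parametric_intervalIntegral_of_continuous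
    (f := fun (q : ℝ × ℝ) z => f q.1 z t)
    (hf.comp (by fun_prop : Continuous fun r : (ℝ × ℝ) × ℝ => (r.1.1, r.2))) continuous_snd

theorem continuous_fiber_integral {F : ℝ → ℝ → ℝ} (hF : Continuous (fun q : ℝ × ℝ => F q.1 q.2)) :
    Continuous (fun x => ∫ y in (0:ℝ)..1, F x y) :=
  intervalIntegral.continuous_parametric_intervalIntegral_of_continuous' hF 0 1

theorem hasDerivAt_iy {f : OF} {t : ℝ} (hf : Continuous (fun q : ℝ × ℝ => f q.1 q.2 t))
    (x y : ℝ) : HasDerivAt (fun s => iy f x s t) (f x y t) y := by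
  have hc : Continuous (fun z => f x z t) := hf.comp (by fun_prop : Continuous fun z => (x, z))
  have h : (fun s => iy f x s t) = fun s => ∫ z in (1:ℝ)..s, f x z t :=
    funext fun s => (intervalIntegral.integral_symm _ _).symm
  rw [h]
  exact intervalIntegral.integral_hasDerivAt_right (hc.intervalIntegrable _ _)
    (hc.stronglyMeasurableAtFilter _ _) hc.continuousAt

theorem iy_top (f : OF) (x t : ℝ) : iy f x 1 t = 0 := by simp [iy]

theorem SmoothO.iy_pdy {f : OF} (hf : SmoothO f) (x y t : ℝ) :
    iy (_root_.pdy f) x y t = f x y t - f x 1 t := by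
  have hc : Continuous (fun z => _root_.pdy f x z t) :=
    (hf.pdy.continuous_slice t).comp (by fun_prop : Continuous fun z => (x, z))
  rw [iy, intervalIntegral.integral_eq_sub_of_hasDerivAt
    (fun z _ => hf.hasDerivAt_y x z t) (hc.intervalIntegrable _ _)]
  ring

/-- Integration by parts in `y`; the boundary terms vanish as `∂_y^{-1} f = 0` at `y = 1`
and `u = 0` at `y = 0`. -/
theorem integral_mul_eq_neg_integral_iy_mul {f u : OF} (hf : SmoothO f) (hu : SmoothO u)
    {x t : ℝ} (h0 : u x 0 t = 0) :
    ∫ y in (0:ℝ)..1, f x y t * u x y t = -∫ y in (0:ℝ)..1, iy f x y t * pdy u x y t := by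
  have hx : Continuous fun z : ℝ => (x, z) := by fun_prop
  have h := intervalIntegral.integral_mul_deriv_eq_deriv_mul (a := 0) (b := 1)
    (fun y _ => hasDerivAt_iy (hf.continuous_slice t) x y)
    (fun y _ => hu.hasDerivAt_y x y t)
    (((hf.continuous_slice t).comp hx).intervalIntegrable _ _)
    (((hu.pdy.continuous_slice t).comp hx).intervalIntegrable _ _)
  rw [h, iy_top, h0]
  simp

/-- The surface terms form a complete square in `L²(Γ)`. -/
theorem integral_sq_gdx_sub {η : GF} (hη : SmoothG η) (a c t : ℝ) :
    ∫ x in (0:ℝ)..1, (a * gdx η x t - c * gdxn 3 η x t)^2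
      = a^2 * nG (gdx η) t + 2 * a * c * nG (gdxn 2 η) t + c^2 * nG (gdxn 3 η) t := by
  have c1 := hη.gdx.continuous_slice t
  have c2 : Continuous fun x => gdxn 2 η x t := hη.gdx.gdx.continuous_slice t
  have c3 : Continuous fun x => gdxn 3 η x t := hη.gdx.gdx.gdx.continuous_slice t
  have p1 : gdx η 1 t = gdx η 0 t := by simpa using hη.gdx.2 t 0
  have p2 : gdxn 2 η 1 t = gdxn 2 η 0 t := by
    simpa [gdxn] using hη.gdx.gdx.2 t 0
  have h := intervalIntegral.integral_mul_deriv_eq_deriv_mul (a := 0) (b := 1)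
    (u := fun x => gdx η x t) (v := fun x => gdxn 2 η x t) (u' := fun x => gdxn 2 η x t)
    (v' := fun x => gdxn 3 η x t)
    (fun x _ => hη.gdx.hasDerivAt x t) (fun x _ => hη.gdx.gdx.hasDerivAt x t)
    (c2.intervalIntegrable _ _) (c3.intervalIntegrable _ _)
  rw [p1, p2, sub_self, zero_sub] at h
  have e : ∀ x, (a * gdx η x t - c * gdxn 3 η x t)^2
      = a^2 * (gdx η x t)^2 - 2 * a * c * (gdx η x t * gdxn 3 η x t)
        + c^2 * (gdxn 3 η x t)^2 := fun x => by ring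
  simp only [e]
  rw [intervalIntegral.integral_add (Continuous.intervalIntegrable (by fun_prop) _ _)
      (Continuous.intervalIntegrable (by fun_prop) _ _),
    intervalIntegral.integral_sub (Continuous.intervalIntegrable (by fun_prop) _ _)
      (Continuous.intervalIntegrable (by fun_prop) _ _)]
  simp only [intervalIntegral.integral_const_mul, h, nG, pow_two (gdxn 2 η _ t)]
  ring

theorem SmoothO.iy_iy_pdy {f : OF} (hf : SmoothO f) (x y t : ℝ) :
    iy (iy (_root_.pdy f)) x y t = iy f x y t + (1 - y) * f x 1 t := by
  have hc : Continuous (fun z => f x z t) :=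
    (hf.continuous_slice t).comp (by fun_prop : Continuous fun z => (x, z))
  rw [iy]
  simp only [hf.iy_pdy]
  rw [intervalIntegral.integral_sub (hc.intervalIntegrable _ _)
    (continuous_const.intervalIntegrable _ _)]
  simp [iy]
  ring

theorem integral_one_sub_sq_mul (c : ℝ) : ∫ y in (0:ℝ)..1, (1 - y)^2 * c = c / 3 := by
  rw [intervalIntegral.integral_mul_const,
    intervalIntegral.integral_comp_sub_left (fun y => y^2) 1]
  norm_num
  ring

/-- Recover a surface value from `∂_y^{-1} f` and `∂_y^{-2} f_y`. -/
theorem SmoothO.sq_trace_add_le {f : OF} (hf : SmoothO f) (x t a b : ℝ) :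
    (1/3) * (f x 1 t + a - b)^2 ≤ 3 * (∫ y in (0:ℝ)..1, (iy f x y t)^2)
      + 3 * (∫ y in (0:ℝ)..1, (iy (iy (_root_.pdy f)) x y t)^2) + 2 * a^2 + 2 * b^2 := by
  have hx : Continuous fun z : ℝ => (x, z) := by fun_prop
  have cP : Continuous fun y => iy f x y t := (continuous_iy (hf.continuous_slice t)).comp hx
  have cS : Continuous fun y => iy (iy (_root_.pdy f)) x y t :=
    (continuous_iy (continuous_iy (hf.pdy.continuous_slice t))).comp hx
  have key : ∫ y in (0:ℝ)..1, (1 - y)^2 * (f x 1 t + a - b)^2 ≤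
      ∫ y in (0:ℝ)..1, (3 * (iy f x y t)^2 + 3 * (iy (iy (_root_.pdy f)) x y t)^2
        + (1 - y)^2 * (6 * a^2 + 6 * b^2)) := by
    refine intervalIntegral.integral_mono_on zero_le_one
      (Continuous.intervalIntegrable (by fun_prop) _ _)
      (Continuous.intervalIntegrable (by fun_prop) _ _) fun y _ => ?_
    have e := hf.iy_iy_pdy x y t
    set S := iy (iy (_root_.pdy f)) x y t
    set P := iy f x y t
    set k := (1 - y) * (a - b)
    have e1 : (1 - y)^2 * (f x 1 t + a - b)^2 = (S - P + k)^2 := by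
      rw [e]; ring
    have e2 : k^2 ≤ (1 - y)^2 * (2 * a^2 + 2 * b^2) := by
      have : k^2 = (1 - y)^2 * (a - b)^2 := by ring
      rw [this]
      gcongr
      nlinarith [sq_nonneg (a + b)]
    rw [e1]
    nlinarith [sq_nonneg (S + P), sq_nonneg (S - k), sq_nonneg (P + k)]
  rw [intervalIntegral.integral_add (Continuous.intervalIntegrable (by fun_prop) _ _)
      (Continuous.intervalIntegrable (by fun_prop) _ _),
    intervalIntegral.integral_add (Continuous.intervalIntegrable (by fun_prop) _ _)
      (Continuous.intervalIntegrable (by fun_prop) _ _), integral_one_sub_sq_mul,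
    integral_one_sub_sq_mul, intervalIntegral.integral_const_mul,
    intervalIntegral.integral_const_mul] at key
  linarith

theorem continuous_line {F : OF} {t : ℝ} (hF : Continuous (fun q : ℝ × ℝ => F q.1 q.2 t))
    (x : ℝ) : Continuous fun y => F x y t :=
  hF.comp (by fun_prop : Continuous fun z : ℝ => (x, z))

theorem ipO_add_right {f g h : OF} {t : ℝ} (hf : Continuous (fun q : ℝ × ℝ => f q.1 q.2 t))
    (hg : Continuous (fun q : ℝ × ℝ => g q.1 q.2 t))
    (hh : Continuous (fun q : ℝ × ℝ => h q.1 q.2 t)) :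
    ipO f (fun x y s => g x y s + h x y s) t = ipO f g t + ipO f h t := by
  simp only [ipO]
  rw [← intervalIntegral.integral_add
    ((continuous_fiber_integral (hf.mul hg)).intervalIntegrable _ _)
    ((continuous_fiber_integral (hf.mul hh)).intervalIntegrable _ _)]
  refine intervalIntegral.integral_congr fun x _ => ?_
  simp only [mul_add]
  exact intervalIntegral.integral_add
    (((continuous_line hf x).mul (continuous_line hg x)).intervalIntegrable _ _)
    (((continuous_line hf x).mul (continuous_line hh x)).intervalIntegrable _ _)

/-- The divergence-free condition extends by continuity to the surface. -/
theorem FilmSystem.incompr_top {δ R W α : ℝ} {η : GF} {u v p : OF}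
    {a11 a12 a22 b2 f1 f2 : OF} {b3 h1 h2 h3 : GF}
    (H : FilmSystem δ R W α η u v p a11 a12 a22 b2 f1 f2 b3 h1 h2 h3) (x t : ℝ) :
    pdx u x 1 t + pdy v x 1 t = 0 := by
  have hc : Continuous fun y => pdx u x y t + pdy v x y t :=
    (continuous_line (H.smooth_u.pdx.continuous_slice t) x).add
      (continuous_line (H.smooth_v.pdy.continuous_slice t) x)
  have hs : closure (Set.Ioo (0:ℝ) 1) ⊆ {y | pdx u x y t + pdy v x y t = 0} :=
    closure_minimal (fun y hy => H.incompr x t y hy) (isClosed_eq hc continuous_const)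
  rw [closure_Ioo zero_ne_one] at hs
  exact hs (Set.right_mem_Icc.2 zero_le_one)

/-- The tangential derivative of the normal stress condition. -/
theorem FilmSystem.normal_stress_dx {δ R W α : ℝ} {η : GF} {u v p : OF}
    {a11 a12 a22 b2 f1 f2 : OF} {b3 h1 h2 h3 : GF}
    (H : FilmSystem δ R W α η u v p a11 a12 a22 b2 f1 f2 b3 h1 h2 h3) (x t : ℝ) :
    (1/Real.tan α) * gdx η x t - (δ^2 * W / Real.sin α) * gdxn 3 η x t
      = pdx p x 1 t + δ * pdxn 2 u x 1 t - gdx h2 x t := by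
  have hL := ((H.smooth_η.hasDerivAt x t).const_mul (1/Real.tan α)).sub
    ((H.smooth_η.gdx.gdx.hasDerivAt x t).const_mul (δ^2 * W / Real.sin α))
  have hR := ((H.smooth_p.hasDerivAt_x x 1 t).add
    ((H.smooth_u.pdx.hasDerivAt_x x 1 t).const_mul δ)).sub (H.smooth_h2.hasDerivAt x t)
  refine hL.unique (hR.congr_of_eventuallyEq (.of_forall fun s => ?_))
  have e1 := H.bc2 s t
  have e2 := H.incompr_top s t
  have e3 : gdxn 2 η s t = gdx (gdx η) s t := rfl
  have e4 : pdy v s 1 t = -pdx u s 1 t := by linarith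
  rw [e3, e4] at e1
  simp only [Pi.add_apply, Pi.sub_apply]
  linarith

/-- **Lemma 3.3 (dissipation from the pressure).**  For a sufficiently smooth solution
of the transformed system,
`(2/R)(δp_x,u)_Ω + (1/3R)((1/tan²α)δ²|η_x|₀² + (2δ²W/(tanα sinα))δ²|η_{xx}|₀²
  + ((δ²W)²/sin²α)δ²|η_{xxx}|₀²) + (1/R)δ²‖∂_y^{-1}p_x‖² ≤ I₁ + I₂ + I₃`. -/
theorem pressure_dissipation_estimate :
    ∀ δ : ℝ, δ ∈ Set.Ioc (0:ℝ) 1 →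
    ∀ R : ℝ, 0 < R →
    ∀ W : ℝ, 0 < W →
    ∀ α : ℝ, α ∈ Set.Ioo (0:ℝ) (π/2) →
    ∀ (η : GF) (u v p : OF) (a11 a12 a22 b2 f1 f2 : OF) (b3 h1 h2 h3 : GF),
      FilmSystem δ R W α η u v p a11 a12 a22 b2 f1 f2 b3 h1 h2 h3 →
      ∀ t : ℝ,
        let I1 : ℝ := -(2/R) * ipO (fun x y s => δ * iy (pdx p) x y s)
          (fun x y s => (2 + b3 x s) * η x s) t
        let I2 : ℝ := -(2/R) * ipO (fun x y s => δ * iy (pdx p) x y s)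
          (fun x y s => -(δ^2 * pdx v x 1 s) + h1 x s
            + iy (fun a b c => pdyn 2 u a b c - 2 * δ * pdx p a b c) x y s) t
        let I3 : ℝ := (1/R) * (2 * δ^4 * nG (tr (pdxn 2 u)) t
          + 2 * δ^2 * nG (gdx h2) t + 3 * δ^2 * nO (iy (iy (pdy (pdx p)))) t)
        (2/R) * ipO (fun x y s => δ * pdx p x y s) u t
          + (1/(3*R)) * ((1/(Real.tan α)^2) * δ^2 * nG (gdx η) t
            + (2 * (δ^2 * W) / (Real.tan α * Real.sin α)) * δ^2 * nG (gdxn 2 η) t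
            + ((δ^2 * W)^2 / (Real.sin α)^2) * δ^2 * nG (gdxn 3 η) t)
          + (1/R) * δ^2 * nO (iy (pdx p)) t
        ≤ I1 + I2 + I3 := by
  intro δ _ R hR W _ α _ η u v p a11 a12 a22 b2 f1 f2 b3 h1 h2 h3 H t I1 I2 I3
  have hpx := H.smooth_p.pdx
  have huyy := H.smooth_u.pdy.pdy
  have cpx := hpx.continuous_slice t
  have cP := continuous_iy cpx
  have cS := continuous_iy (continuous_iy (hpx.pdy.continuous_slice t))
  have cP2 : Continuous fun x => ∫ y in (0:ℝ)..1, (iy (pdx p) x y t)^2 :=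
    continuous_fiber_integral (cP.pow 2 : Continuous fun q : ℝ × ℝ => (iy (pdx p) q.1 q.2 t)^2)
  have cS2 : Continuous fun x => ∫ y in (0:ℝ)..1, (iy (iy (pdy (pdx p))) x y t)^2 :=
    continuous_fiber_integral
      (cS.pow 2 : Continuous fun q : ℝ × ℝ => (iy (iy (pdy (pdx p))) q.1 q.2 t)^2)
  have cuy := H.smooth_u.pdy.continuous_slice t
  have cuyy := huyy.continuous_slice t
  have hiy : ∀ x y, iy (fun a b c => pdyn 2 u a b c - 2 * δ * pdx p a b c) x y t
      = pdy u x y t - pdy u x 1 t - 2 * δ * iy (pdx p) x y t := by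
    intro x y
    have h : ∫ z in y..1, (pdyn 2 u x z t - 2 * δ * pdx p x z t)
        = (∫ z in y..1, pdy (pdy u) x z t) - 2 * δ * ∫ z in y..1, pdx p x z t := by
      rw [← intervalIntegral.integral_const_mul]
      exact intervalIntegral.integral_sub ((continuous_line cuyy x).intervalIntegrable _ _)
        ((continuous_const.mul (continuous_line cpx x)).intervalIntegrable _ _)
    rw [← H.smooth_u.pdy.iy_pdy x y t]
    simp only [iy, h]
    ring
  have hdiss : I1 + I2 = (2/R) * ipO (fun x y s => δ * pdx p x y s) u t
      + (4/R) * δ^2 * nO (iy (pdx p)) t := by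
    have c1 : Continuous fun q : ℝ × ℝ => (2 + b3 q.1 t) * η q.1 t :=
      (continuous_const.add ((H.smooth_b3.continuous_slice t).comp continuous_fst)).mul
        ((H.smooth_η.continuous_slice t).comp continuous_fst)
    have c2 : Continuous fun q : ℝ × ℝ => -(δ^2 * pdx v q.1 1 t) + h1 q.1 t
        + iy (fun a b c => pdyn 2 u a b c - 2 * δ * pdx p a b c) q.1 q.2 t :=
      (((continuous_const.mul ((H.smooth_v.pdx.continuous_slice t).comp
        (by fun_prop : Continuous fun q : ℝ × ℝ => (q.1, (1:ℝ))))).neg).add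
        ((H.smooth_h1.continuous_slice t).comp continuous_fst)).add
        (continuous_iy (cuyy.sub (continuous_const.mul cpx)))
    have hsum := ipO_add_right (f := fun x y s => δ * iy (pdx p) x y s)
      (g := fun x y s => (2 + b3 x s) * η x s)
      (h := fun x y s => -(δ^2 * pdx v x 1 s) + h1 x s
            + iy (fun a b c => pdyn 2 u a b c - 2 * δ * pdx p a b c) x y s) (t := t)
      (continuous_const.mul cP) c1 c2
    have hval : ipO (fun x y s => δ * iy (pdx p) x y s)
        (fun x y s => (2 + b3 x s) * η x s + (-(δ^2 * pdx v x 1 s) + h1 x s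
            + iy (fun a b c => pdyn 2 u a b c - 2 * δ * pdx p a b c) x y s)) t
        = -ipO (fun x y s => δ * pdx p x y s) u t - 2 * δ^2 * nO (iy (pdx p)) t := by
      have cpu : Continuous fun x => -∫ y in (0:ℝ)..1, δ * pdx p x y t * u x y t :=
        (continuous_fiber_integral ((continuous_const.mul cpx).mul
          (H.smooth_u.continuous_slice t))).neg
      simp only [ipO, nO]
      rw [← intervalIntegral.integral_neg, ← intervalIntegral.integral_const_mul,
        ← intervalIntegral.integral_sub
          (Continuous.intervalIntegrable cpu _ _) (Continuous.intervalIntegrable (by fun_prop) _ _)]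
      refine intervalIntegral.integral_congr fun x _ => ?_
      have lP := continuous_line cP x
      have luy := continuous_line cuy x
      have e : ∀ y, δ * iy (pdx p) x y t * ((2 + b3 x t) * η x t + (-(δ^2 * pdx v x 1 t) + h1 x t
          + iy (fun a b c => pdyn 2 u a b c - 2 * δ * pdx p a b c) x y t))
          = δ * (iy (pdx p) x y t * pdy u x y t) - 2 * δ^2 * (iy (pdx p) x y t)^2 := by
        intro y
        rw [hiy, ← H.bc1 x t]
        ring
      simp only [e, mul_assoc δ (pdx p x _ t)]
      rw [intervalIntegral.integral_sub (Continuous.intervalIntegrable (by fun_prop) _ _)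
        (Continuous.intervalIntegrable (by fun_prop) _ _)]
      simp only [intervalIntegral.integral_const_mul]
      rw [integral_mul_eq_neg_integral_iy_mul hpx H.smooth_u (H.noslip x t).1]
      ring
    have : I1 + I2 = -(2/R) * (-ipO (fun x y s => δ * pdx p x y s) u t
        - 2 * δ^2 * nO (iy (pdx p)) t) := by
      rw [← hval, hsum]
      simp only [I1, I2]
      ring
    rw [this]
    ring
  have hsurf : (1/3) * ((1/Real.tan α)^2 * nG (gdx η) t
      + 2 * (1/Real.tan α) * (δ^2 * W / Real.sin α) * nG (gdxn 2 η) t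
      + (δ^2 * W / Real.sin α)^2 * nG (gdxn 3 η) t)
      ≤ 3 * nO (iy (pdx p)) t + 3 * nO (iy (iy (pdy (pdx p)))) t
        + 2 * δ^2 * nG (tr (pdxn 2 u)) t + 2 * nG (gdx h2) t := by
    rw [← integral_sq_gdx_sub H.smooth_η]
    have cu : Continuous fun x => pdxn 2 u x 1 t :=
      (H.smooth_u.pdx.pdx.continuous_slice t).comp
        (by fun_prop : Continuous fun x : ℝ => (x, (1:ℝ)))
    have cpt : Continuous fun x => pdx p x 1 t :=
      cpx.comp (by fun_prop : Continuous fun x : ℝ => (x, (1:ℝ)))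
    have ch := H.smooth_h2.gdx.continuous_slice t
    simp only [H.normal_stress_dx, nO, nG, tr, ← intervalIntegral.integral_const_mul]
    rw [← intervalIntegral.integral_add (Continuous.intervalIntegrable (by fun_prop) _ _)
        (Continuous.intervalIntegrable (by fun_prop) _ _),
      ← intervalIntegral.integral_add (Continuous.intervalIntegrable (by fun_prop) _ _)
        (Continuous.intervalIntegrable (by fun_prop) _ _),
      ← intervalIntegral.integral_add (Continuous.intervalIntegrable (by fun_prop) _ _)
        (Continuous.intervalIntegrable (by fun_prop) _ _)]
    refine intervalIntegral.integral_mono_on zero_le_one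
      (Continuous.intervalIntegrable (by fun_prop) _ _)
      (Continuous.intervalIntegrable (by fun_prop) _ _) fun x _ => ?_
    have := hpx.sq_trace_add_le x t (δ * pdxn 2 u x 1 t) (gdx h2 x t)
    simp only [intervalIntegral.integral_const_mul]
    rw [mul_pow] at this
    linarith
  have hm := mul_le_mul_of_nonneg_left hsurf (by positivity : 0 ≤ δ^2 / R)
  rw [hdiss]
  simp only [I3]
  have hl : (1/(3*R)) * ((1/(Real.tan α)^2) * δ^2 * nG (gdx η) t
            + (2 * (δ^2 * W) / (Real.tan α * Real.sin α)) * δ^2 * nG (gdxn 2 η) t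
            + ((δ^2 * W)^2 / (Real.sin α)^2) * δ^2 * nG (gdxn 3 η) t)
      = δ^2 / R * ((1/3) * ((1/Real.tan α)^2 * nG (gdx η) t
      + 2 * (1/Real.tan α) * (δ^2 * W / Real.sin α) * nG (gdxn 2 η) t
      + (δ^2 * W / Real.sin α)^2 * nG (gdxn 3 η) t)) := by
    simp only [div_eq_mul_inv, mul_inv, one_mul, inv_pow]
    ring
  rw [hl]
  refine le_trans (add_le_add_left (add_le_add_right hm _) _) (le_of_eq ?_)
  ring
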